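/- Let G be a finite undirected d-regular graph with normalized adjacency matrix A, let ε > 0, and let p, q ≥ 1 with p < q. Then for every vertex subset S ⊆ V, the non-expansion satisfies 1 − Φ(S) ≤ ‖P_ε‖_{p→q} · μ(S)^{1/p − 1/q} + ε. -/

import Mathlib

open Finset
open scoped ENNReal BigOperators

noncomputable section

variable {V : Type*} [Fintype V] [DecidableEq V]

/-- The `L_p` norm with expectation (uniform-probability) normalization, `p ∈ [1, ∞]`. -/
def lpN (p : ℝ≥0∞) (x : V → ℝ) : ℝ :=
  if p = ∞ then ⨆ i, |x i|
  else ((∑ i, |x i| ^ p.toReal) / (Fintype.card V : ℝ)) ^ (1 / p.toReal)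

/-- The `L_p` norm with expectation normalization, for a real exponent `p`. -/
def lpNR (p : ℝ) (x : V → ℝ) : ℝ :=
  ((∑ i, |x i| ^ p) / (Fintype.card V : ℝ)) ^ (1 / p)

/-- The `p → q` operator norm (with respect to the expectation-normalized `L_p` norms). -/
def opNorm (p q : ℝ≥0∞) (T : (V → ℝ) →ₗ[ℝ] (V → ℝ)) : ℝ :=
  ⨆ x : V → ℝ, lpN q (T x) / lpN p x

/-- The `p → q` operator norm for real exponents. -/
def opNormR (p q : ℝ) (T : (V → ℝ) →ₗ[ℝ] (V → ℝ)) : ℝ :=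
  ⨆ x : V → ℝ, lpNR q (T x) / lpNR p x

/-- The expectation inner product `⟨v, w⟩ = (1/n) ∑ i, v i * w i`. -/
def eInner (v w : V → ℝ) : ℝ := (∑ i, v i * w i) / (Fintype.card V : ℝ)

/-- The expectation-normalized `L_2` norm. -/
def l2norm (v : V → ℝ) : ℝ := Real.sqrt ((∑ i, (v i) ^ 2) / (Fintype.card V : ℝ))

/-- `V_λ`: the direct sum of the eigenspaces of the matrix `A` with eigenvalue `≥ lam`. -/
def topEigenspace (A : Matrix V V ℝ) (lam : ℝ) : Submodule ℝ (V → ℝ) :=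
  ⨆ μ : {μ : ℝ // lam ≤ μ}, Module.End.eigenspace (Matrix.toLin' A) (μ : ℝ)

/-- The density `μ(S) = |S| / n` of a set of vertices. -/
def density (S : Finset V) : ℝ := (S.card : ℝ) / (Fintype.card V : ℝ)

/-- The edge expansion `Φ(S)`: the fraction of the `d * |S|` edge endpoints at `S`
that go to a vertex outside of `S`. -/
def expansion (G : SimpleGraph V) [DecidableRel G.Adj] (d : ℕ) (S : Finset V) : ℝ :=
  (∑ v ∈ S, ∑ w ∈ Sᶜ, if G.Adj v w then (1 : ℝ) else 0) / ((d : ℝ) * (S.card : ℝ))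

theorem lpNR_nonneg {V : Type*} [Fintype V] (p : ℝ) (x : V → ℝ) : 0 ≤ lpNR p x :=
  Real.rpow_nonneg (by positivity) _

theorem lpNR_rpow {V : Type*} [Fintype V] {p : ℝ} (hp : 0 < p) (x : V → ℝ) :
    lpNR p x ^ p = (∑ i, |x i| ^ p) / (Fintype.card V : ℝ) := by
  rw [lpNR, ← Real.rpow_mul (by positivity), one_div_mul_cancel hp.ne', Real.rpow_one]

theorem abs_apply_le_lpNR {V : Type*} [Fintype V] [Nonempty V] {p : ℝ} (hp : 0 < p) (x : V → ℝ)
    (j : V) :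
    |x j| ≤ (Fintype.card V : ℝ) ^ (1 / p) * lpNR p x := by
  have hn : (0 : ℝ) < Fintype.card V := by exact_mod_cast Fintype.card_pos
  have hL := lpNR_nonneg p x
  rw [← Real.rpow_le_rpow_iff (abs_nonneg _) (by positivity) hp,
    Real.mul_rpow (by positivity) hL, lpNR_rpow hp, ← Real.rpow_mul hn.le,
    one_div_mul_cancel hp.ne', Real.rpow_one, mul_div_cancel₀ _ hn.ne']
  exact Finset.single_le_sum (f := fun i => |x i| ^ p) (fun i _ => by positivity)
    (Finset.mem_univ j)

theorem lpNR_le_of_abs_le {V : Type*} [Fintype V] [Nonempty V] {q : ℝ} (hq : 0 < q) {y : V → ℝ}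
    {B : ℝ} (hB : 0 ≤ B)
    (h : ∀ i, |y i| ≤ B) : lpNR q y ≤ B := by
  have hn : (0 : ℝ) < Fintype.card V := by exact_mod_cast Fintype.card_pos
  rw [← Real.rpow_le_rpow_iff (lpNR_nonneg q y) hB hq, lpNR_rpow hq, div_le_iff₀ hn]
  calc ∑ i, |y i| ^ q ≤ ∑ _i : V, B ^ q := by gcongr with i; exact h i
    _ = B ^ q * Fintype.card V := by simp [mul_comm]

theorem bddAbove_range_lpNR_div [Nonempty V] {p q : ℝ} (hp : 0 < p) (hq : 0 < q)
    (T : (V → ℝ) →ₗ[ℝ] (V → ℝ)) :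
    BddAbove (Set.range fun x : V → ℝ => lpNR q (T x) / lpNR p x) := by
  set c : ℝ := (Fintype.card V : ℝ) ^ (1 / p)
  have hc : 0 ≤ c := by positivity
  set K : ℝ := ∑ i, ∑ j, |LinearMap.toMatrix' T i j| * c
  have hK : 0 ≤ K := by positivity
  refine ⟨K, ?_⟩
  rintro _ ⟨x, rfl⟩
  have hL := lpNR_nonneg p x
  refine div_le_of_le_mul₀ hL hK (lpNR_le_of_abs_le hq (by positivity) fun i => ?_)
  have hTx : T x i = ∑ j, LinearMap.toMatrix' T i j * x j := by
    conv_lhs => rw [← Matrix.toLin'_toMatrix' T]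
    rfl
  calc |T x i| ≤ ∑ j, |LinearMap.toMatrix' T i j * x j| := by
        rw [hTx]; exact Finset.abs_sum_le_sum_abs _ _
    _ ≤ ∑ j, |LinearMap.toMatrix' T i j| * c * lpNR p x := by
        gcongr with j
        rw [abs_mul, mul_assoc]
        gcongr
        exact abs_apply_le_lpNR hp x j
    _ = (∑ j, |LinearMap.toMatrix' T i j| * c) * lpNR p x := by rw [Finset.sum_mul]
    _ ≤ K * lpNR p x := by
        gcongr
        exact Finset.single_le_sum (f := fun i => ∑ j, |LinearMap.toMatrix' T i j| * c)
          (fun i _ => by positivity) (Finset.mem_univ i)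

theorem lpNR_apply_le_opNormR_mul [Nonempty V] {p q : ℝ} (hp : 0 < p) (hq : 0 < q)
    (T : (V → ℝ) →ₗ[ℝ] (V → ℝ)) {x : V → ℝ} (hx : 0 < lpNR p x) :
    lpNR q (T x) ≤ opNormR p q T * lpNR p x := by
  rw [← div_le_iff₀ hx]
  exact le_ciSup (bddAbove_range_lpNR_div hp hq T) x

theorem density_pos {V : Type*} [Fintype V] [Nonempty V] {S : Finset V} (hS : S.Nonempty) :
    0 < density S :=
  div_pos (by exact_mod_cast hS.card_pos) (by exact_mod_cast Fintype.card_pos)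

theorem lpNR_indicator {p : ℝ} (hp : 0 < p) (S : Finset V) :
    lpNR p (fun i => if i ∈ S then (1 : ℝ) else 0) = density S ^ (1 / p) := by
  have h : ∀ i, |if i ∈ S then (1 : ℝ) else 0| ^ p = if i ∈ S then (1 : ℝ) else 0 := by
    intro i
    split_ifs <;> simp [hp.ne']
  simp [lpNR, h, density]

theorem sum_div_card_le_lpNR {V : Type*} [Fintype V] [Nonempty V] {q : ℝ} (hq : 1 ≤ q)
    (y : V → ℝ) {S : Finset V}
    (hS : S.Nonempty) :
    (∑ i ∈ S, y i) / (S.card : ℝ) ≤ density S ^ (-(1 / q)) * lpNR q y := by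
  have hs : (0 : ℝ) < S.card := by exact_mod_cast hS.card_pos
  have hn : (0 : ℝ) < Fintype.card V := by exact_mod_cast Fintype.card_pos
  have hq0 : 0 < q := by linarith
  have hL := lpNR_nonneg q y
  have hdens := density_pos hS
  calc (∑ i ∈ S, y i) / (S.card : ℝ) ≤ (∑ i ∈ S, |y i|) / (S.card : ℝ) := by
        gcongr with i; exact le_abs_self _
    _ ≤ density S ^ (-(1 / q)) * lpNR q y := by
      rw [← Real.rpow_le_rpow_iff (by positivity) (by positivity) hq0,
        Real.div_rpow (by positivity) hs.le, Real.mul_rpow (by positivity) hL,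
        ← Real.rpow_mul hdens.le, lpNR_rpow hq0, neg_mul, one_div_mul_cancel hq0.ne',
        Real.rpow_neg_one, density, div_le_iff₀ (by positivity)]
      have h := Real.rpow_sum_le_const_mul_sum_rpow S y hq
      have h2 : ∑ i ∈ S, |y i| ^ q ≤ ∑ i, |y i| ^ q :=
        Finset.sum_le_sum_of_subset_of_nonneg (Finset.subset_univ S) fun i _ _ => by positivity
      calc (∑ i ∈ S, |y i|) ^ q ≤ (S.card : ℝ) ^ (q - 1) * ∑ i ∈ S, |y i| ^ q := h
        _ ≤ (S.card : ℝ) ^ (q - 1) * ∑ i, |y i| ^ q := by gcongr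
        _ = _ := by rw [Real.rpow_sub_one hs.ne']; field_simp

theorem eInner_eq_dotProduct_div {V : Type*} [Fintype V] (v w : V → ℝ) :
    eInner v w = v ⬝ᵥ w / (Fintype.card V : ℝ) := rfl

theorem mulVec_mem_topEigenspace {A : Matrix V V ℝ} {lam : ℝ} {x : V → ℝ}
    (hx : x ∈ topEigenspace A lam) : A.mulVec x ∈ topEigenspace A lam := by
  refine Submodule.iSup_induction (motive := fun x => A.mulVec x ∈ topEigenspace A lam) _ hx
    ?_ ?_ ?_
  · intro μ y hy
    have h : A.mulVec y = (μ : ℝ) • y := by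
      simpa using Module.End.mem_eigenspace_iff.mp hy
    rw [h]
    exact Submodule.smul_mem _ _ (Submodule.mem_iSup_of_mem μ hy)
  · simp
  · intro y z hy hz
    rw [Matrix.mulVec_add]
    exact Submodule.add_mem _ hy hz

theorem dotProduct_mulVec_self_le_of_orthogonal {A : Matrix V V ℝ} (hA : A.IsHermitian)
    {lam : ℝ} {y : V → ℝ} (hy : ∀ w ∈ topEigenspace A lam, y ⬝ᵥ w = 0) :
    y ⬝ᵥ A.mulVec y ≤ lam * (y ⬝ᵥ y) := by
  set b := hA.eigenvectorBasis
  have hb : ∀ i, A.mulVec (b i) = hA.eigenvalues i • (b i : V → ℝ) :=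
    fun i => hA.mulVec_eigenvectorBasis i
  have hexp : ∀ v w : V → ℝ, v ⬝ᵥ w = ∑ i, (v ⬝ᵥ (b i : V → ℝ)) * ((b i : V → ℝ) ⬝ᵥ w) := by
    intro v w
    have h := b.sum_inner_mul_inner (WithLp.toLp 2 v) (WithLp.toLp 2 w)
    simp only [EuclideanSpace.inner_eq_star_dotProduct, star_trivial] at h
    rw [dotProduct_comm v w, ← h]
    refine Finset.sum_congr rfl fun i _ => ?_
    rw [dotProduct_comm v, dotProduct_comm _ w]
  have hT : A.transpose = A := by simpa using hA.eq
  rw [hexp y (A.mulVec y), hexp y y, Finset.mul_sum]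
  refine Finset.sum_le_sum fun i _ => ?_
  have h1 : (b i : V → ℝ) ⬝ᵥ A.mulVec y = hA.eigenvalues i * ((b i : V → ℝ) ⬝ᵥ y) := by
    rw [Matrix.dotProduct_mulVec, ← Matrix.mulVec_transpose, hT, hb, smul_dotProduct,
      smul_eq_mul]
  rw [h1]
  rcases le_or_gt lam (hA.eigenvalues i) with h | h
  · have hmem : (b i : V → ℝ) ∈ topEigenspace A lam := by
      refine Submodule.mem_iSup_of_mem ⟨hA.eigenvalues i, h⟩ ?_
      rw [Module.End.mem_eigenspace_iff]
      simpa using hb i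
    simp [hy _ hmem]
  · rw [dotProduct_comm (b i : V → ℝ) y]
    nlinarith [mul_self_nonneg (y ⬝ᵥ (b i : V → ℝ))]

theorem dotProduct_mulVec_self_le_of_stochastic {V : Type*} [Fintype V] {A : Matrix V V ℝ}
    (hA : A.IsSymm)
    (hnonneg : ∀ i j, 0 ≤ A i j) (hrow : ∀ i, ∑ j, A i j = 1) (z : V → ℝ) :
    z ⬝ᵥ A.mulVec z ≤ z ⬝ᵥ z := by
  have h1 : ∑ i, ∑ j, A i j * (z i * z i) = z ⬝ᵥ z := by
    simp [← Finset.sum_mul, hrow, dotProduct]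
  have h2 : ∑ i, ∑ j, A i j * (z j * z j) = z ⬝ᵥ z := by
    rw [Finset.sum_comm, ← h1]
    simp only [hA.apply]
  calc z ⬝ᵥ A.mulVec z = ∑ i, ∑ j, A i j * (z i * z j) := by
        simp only [dotProduct, Matrix.mulVec, Finset.mul_sum]
        refine Finset.sum_congr rfl fun i _ => Finset.sum_congr rfl fun j _ => by ring
    _ ≤ ∑ i, ∑ j, (A i j * (z i * z i) + A i j * (z j * z j)) / 2 := by
        refine Finset.sum_le_sum fun i _ => Finset.sum_le_sum fun j _ => ?_
        nlinarith [mul_nonneg (hnonneg i j) (sq_nonneg (z i - z j))]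
    _ = z ⬝ᵥ z := by
        simp only [← Finset.sum_div, Finset.sum_add_distrib, h1, h2]
        ring

theorem sum_adj_eq_of_isRegularOfDegree {V : Type*} [Fintype V] {G : SimpleGraph V}
    [DecidableRel G.Adj] {d : ℕ}
    (hreg : G.IsRegularOfDegree d) (v : V) :
    ∑ w, (if G.Adj v w then (1 : ℝ) else 0) = d := by
  rw [← hreg.degree_eq v, ← G.card_neighborFinset_eq_degree, Finset.sum_boole,
    G.neighborFinset_eq_filter]

theorem one_sub_expansion_eq {G : SimpleGraph V} [DecidableRel G.Adj] {d : ℕ} (hd : 0 < d)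
    (hreg : G.IsRegularOfDegree d) {S : Finset V} (hS : S.Nonempty) :
    1 - expansion G d S =
      (fun i => if i ∈ S then (1 : ℝ) else 0) ⬝ᵥ
        ((d : ℝ)⁻¹ • G.adjMatrix ℝ).mulVec (fun i => if i ∈ S then (1 : ℝ) else 0) / S.card := by
  have hs : (0 : ℝ) < S.card := by exact_mod_cast hS.card_pos
  have hd' : (0 : ℝ) < d := by exact_mod_cast hd
  have hsplit : (∑ v ∈ S, ∑ w ∈ S, if G.Adj v w then (1 : ℝ) else 0) +
      (∑ v ∈ S, ∑ w ∈ Sᶜ, if G.Adj v w then (1 : ℝ) else 0) = S.card * d := by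
    rw [← Finset.sum_add_distrib]
    simp only [Finset.sum_add_sum_compl, sum_adj_eq_of_isRegularOfDegree hreg,
      Finset.sum_const, nsmul_eq_mul]
  have hdot : (fun i => if i ∈ S then (1 : ℝ) else 0) ⬝ᵥ
      ((d : ℝ)⁻¹ • G.adjMatrix ℝ).mulVec (fun i => if i ∈ S then (1 : ℝ) else 0) =
      (d : ℝ)⁻¹ * ∑ v ∈ S, ∑ w ∈ S, if G.Adj v w then (1 : ℝ) else 0 := by
    rw [Matrix.smul_mulVec, dotProduct_smul, smul_eq_mul]
    simp only [dotProduct, Matrix.mulVec, SimpleGraph.adjMatrix_apply, mul_ite, mul_one,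
      mul_zero, ite_mul, one_mul, zero_mul, Finset.sum_ite_mem, Finset.univ_inter]
  rw [hdot, expansion, eq_sub_iff_add_eq.mpr hsplit]
  field_simp

/-- **The easy direction: hypercontractivity implies small-set expansion.**
For any nonempty `S ⊆ V`, the non-expansion satisfies
`1 - Φ(S) ≤ ‖P_ε‖_{p→q} · μ(S)^{1/p - 1/q} + ε`. -/
theorem hypercontractivity_implies_sse {V : Type*} [Fintype V] [DecidableEq V] [Nonempty V]
    (G : SimpleGraph V) [DecidableRel G.Adj] (d : ℕ) (hd : 0 < d)
    (hreg : G.IsRegularOfDegree d)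
    (A : Matrix V V ℝ) (hA : A = (d : ℝ)⁻¹ • G.adjMatrix ℝ)
    (ε : ℝ) (hε : 0 < ε)
    (P : (V → ℝ) →ₗ[ℝ] (V → ℝ))
    (hPmem : ∀ x, P x ∈ topEigenspace A ε)
    (hPid : ∀ x ∈ topEigenspace A ε, P x = x)
    (hPorth : ∀ x : V → ℝ, ∀ w ∈ topEigenspace A ε, eInner (x - P x) w = 0)
    (p q : ℝ) (hp : 1 ≤ p) (hq : 1 ≤ q) (hpq : p < q) :
    ∀ S : Finset V, S.Nonempty →
      1 - expansion G d S ≤ opNormR p q P * density S ^ (1/p - 1/q) + ε := by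
  intro S hS
  have hs : (0 : ℝ) < S.card := by exact_mod_cast hS.card_pos
  have hn : (Fintype.card V : ℝ) ≠ 0 := by exact_mod_cast Fintype.card_ne_zero
  have hd' : (d : ℝ) ≠ 0 := by exact_mod_cast hd.ne'
  have hp0 : 0 < p := by linarith
  have hq0 : 0 < q := by linarith
  have hdens := density_pos hS
  set x : V → ℝ := fun i => if i ∈ S then 1 else 0 with hx
  have hsymm : A.IsSymm := by
    rw [hA]; exact (G.isSymm_adjMatrix (α := ℝ)).smul _
  have hherm : A.IsHermitian := by
    rw [Matrix.IsHermitian, Matrix.conjTranspose_eq_transpose_of_trivial]; exact hsymm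
  have hnonneg : ∀ i j, 0 ≤ A i j := by
    intro i j
    rw [hA, Matrix.smul_apply, SimpleGraph.adjMatrix_apply]
    split_ifs <;> simp
  have hrow : ∀ i, ∑ j, A i j = 1 := by
    intro i
    simp only [hA, Matrix.smul_apply, SimpleGraph.adjMatrix_apply, smul_eq_mul,
      ← Finset.mul_sum, sum_adj_eq_of_isRegularOfDegree hreg, inv_mul_cancel₀ hd']
  set z := P x with hz
  set y := x - z with hy
  have horth : ∀ w ∈ topEigenspace A ε, y ⬝ᵥ w = 0 := by
    intro w hw
    have h := hPorth x w hw
    rw [eInner_eq_dotProduct_div, div_eq_zero_iff] at h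
    exact h.resolve_right hn
  have hzmem : z ∈ topEigenspace A ε := hPmem x
  have hyz : y ⬝ᵥ z = 0 := horth z hzmem
  have hxy : x = z + y := by simp [hy]
  have hyAz : y ⬝ᵥ A.mulVec z = 0 := horth _ (mulVec_mem_topEigenspace hzmem)
  have hzAy : z ⬝ᵥ A.mulVec y = 0 := by
    rw [Matrix.dotProduct_mulVec, ← Matrix.mulVec_transpose, hsymm.eq, dotProduct_comm, hyAz]
  have hquad : x ⬝ᵥ A.mulVec x = z ⬝ᵥ A.mulVec z + y ⬝ᵥ A.mulVec y := by
    rw [hxy, Matrix.mulVec_add, add_dotProduct, dotProduct_add, dotProduct_add, hyAz, hzAy]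
    ring
  have hxx : x ⬝ᵥ x = S.card := by simp [hx, dotProduct]
  have hxz : x ⬝ᵥ z = z ⬝ᵥ z := by
    conv_lhs => rw [hxy, add_dotProduct, hyz, add_zero]
  have hnorm : x ⬝ᵥ x = z ⬝ᵥ z + y ⬝ᵥ y := by
    rw [hxy, add_dotProduct, dotProduct_add, dotProduct_add, hyz, dotProduct_comm z y, hyz]
    ring
  have hzz : 0 ≤ z ⬝ᵥ z := Finset.sum_nonneg fun i _ => mul_self_nonneg (z i)
  have hzA := dotProduct_mulVec_self_le_of_stochastic hsymm hnonneg hrow z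
  have hyA := dotProduct_mulVec_self_le_of_orthogonal hherm horth
  have hsum : x ⬝ᵥ z = ∑ i ∈ S, z i := by simp [hx, dotProduct]
  have hlp : lpNR p x = density S ^ (1 / p) := lpNR_indicator hp0 S
  have hop : lpNR q z ≤ opNormR p q P * density S ^ (1 / p) := by
    rw [← hlp]
    exact lpNR_apply_le_opNormR_mul hp0 hq0 P (by rw [hlp]; positivity)
  have hmean : z ⬝ᵥ z / S.card ≤ opNormR p q P * density S ^ (1 / p - 1 / q) := by
    calc z ⬝ᵥ z / S.card = (∑ i ∈ S, z i) / S.card := by rw [← hsum, hxz]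
      _ ≤ density S ^ (-(1 / q)) * lpNR q z := sum_div_card_le_lpNR hq z hS
      _ ≤ density S ^ (-(1 / q)) * (opNormR p q P * density S ^ (1 / p)) := by gcongr
      _ = opNormR p q P * density S ^ (1 / p - 1 / q) := by
        rw [sub_eq_add_neg, Real.rpow_add hdens]; ring
  have hle : x ⬝ᵥ A.mulVec x ≤ z ⬝ᵥ z + ε * S.card := by
    nlinarith
  calc 1 - expansion G d S = x ⬝ᵥ A.mulVec x / S.card := by
        rw [one_sub_expansion_eq hd hreg hS, hA]
    _ ≤ (z ⬝ᵥ z + ε * S.card) / S.card := div_le_div_of_nonneg_right hle hs.le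
    _ = z ⬝ᵥ z / S.card + ε := by rw [add_div, mul_div_cancel_right₀ _ hs.ne']
    _ ≤ _ := add_le_add_left hmean ε

end
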